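/- (Theorem 3.3) Let 1 < α < 2, μ < 0, C > 0, M > 0, and let S_α : [0,∞) → B(X) be a strongly continuous family of bounded linear operators on a Banach space X with S_α(0) = I and ‖S_α(t)‖ ≤ CM/(1 + |μ|t^α) for all t ≥ 0. Let r > 0, ω > 0, φ ∈ C = C([−r,0],X), and let g, f : [0,∞) × C → X satisfy: g, f ∈ PSAP_{ω,r}(C,X); g(·,0), f(·,0) ∈ C_b([0,∞),X); there exists a bounded continuous L_g : [0,∞) → ℝ⁺ with ‖g(t,ψ)−g(t,φ)‖ ≤ L_g(t)‖ψ−φ‖_C, and there exists L_f : [0,∞) → ℝ⁺ bounded continuous and locally integrable with ‖f(t,ψ)−f(t,φ)‖ ≤ L_f(t)‖ψ−φ‖_C, for all t ≥ 0 and ψ, φ ∈ C. Define W_f(t) = ∫_0^t L_f(s)/(1 + |μ|(t−s)^α) ds. If CM·sup_{t≥0} W_f(t) + ‖L_g‖_∞ < 1, then there exists a unique function u ∈ C_b([−r,∞),X) with u_0 = φ, u(t) = S_α(t)[φ(0) − g(0,φ)] + g(t,u_t) + ∫_0^t S_α(t−s) f(s,u_s) ds for all t ≥ 0, and the restriction of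 u to [0,∞) belongs to PSAP_{ω,r}(X). -/

import Mathlib

open MeasureTheory Filter Set

/-- `v ∈ PSAP_{ω,r}(Y)`: pseudo S-asymptotically ω-periodic of class r. -/
def PSAPclass {Y : Type*} [NormedAddCommGroup Y] (ω r : ℝ) (v : ℝ → Y) : Prop :=
  Tendsto (fun T : ℝ => (1 / T) * ∫ s in r..T, ⨆ τ ∈ Set.Icc (s - r) s, ‖v (τ + ω) - v τ‖)
    atTop (nhds 0)

/-- `F ∈ PSAP_{ω,r}(E,Y)`: uniformly pseudo S-asymptotically ω-periodic of class r. -/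
def PSAPunif {E Y : Type*} [NormedAddCommGroup E] [NormedAddCommGroup Y] (ω r : ℝ)
    (F : ℝ → E → Y) : Prop :=
  ∀ L > 0, Tendsto (fun T : ℝ => (1 / T) * ∫ s in r..T,
      ⨆ τ ∈ Set.Icc (s - r) s, ⨆ x ∈ {x : E | ‖x‖ ≤ L}, ‖F (τ + ω) x - F τ x‖)
    atTop (nhds 0)

/-- The history `u_t ∈ C([−r,0],X)`, `u_t(θ) = u(t+θ)`. -/
noncomputable def hist {X : Type*} [NormedAddCommGroup X] (r : ℝ) (u : ℝ → X) (t : ℝ) :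
    C(Set.Icc (-r) (0:ℝ), X) := by
  classical
  exact if h : Continuous (fun θ : Set.Icc (-r) (0:ℝ) => u (t + ↑θ)) then ⟨_, h⟩ else 0

/-- `u` is a mild solution of system (1.2) with initial history `φ`:
`u ∈ C_b([−r,∞),X)`, `u_0 = φ`, and
`u(t) = S_α(t)[φ(0) − g(0,φ)] + g(t,u_t) + ∫_0^t S_α(t−s) f(s,u_s) ds` for `t ≥ 0`. -/
def IsMildSolution {X : Type*} [NormedAddCommGroup X] [NormedSpace ℝ X]
    (r : ℝ) (h0 : (0:ℝ) ∈ Set.Icc (-r) (0:ℝ))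
    (S : ℝ → X →L[ℝ] X) (φ : C(Set.Icc (-r) (0:ℝ), X))
    (g f : ℝ → C(Set.Icc (-r) (0:ℝ), X) → X) (u : ℝ → X) : Prop :=
  ContinuousOn u (Set.Ici (-r)) ∧ (∃ B, ∀ t ≥ -r, ‖u t‖ ≤ B) ∧
  (∀ θ : Set.Icc (-r) (0:ℝ), u ↑θ = φ θ) ∧
  ∀ t ≥ (0:ℝ), u t = S t (φ ⟨0, h0⟩ - g 0 φ) + g t (hist r u t) +
    ∫ s in (0:ℝ)..t, S (t - s) (f s (hist r u s))

open scoped ENNReal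

/-- The suprema of `D` over the windows `[s - r, s]` have mean zero on `[0, ∞)`: for every `ε > 0`
they are eventually dominated by a measurable function with mean at most `ε`. -/
def WindowMeanNull (r : ℝ) (D : ℝ → ℝ≥0∞) : Prop :=
  ∀ ε : ℝ, 0 < ε → ∃ H : ℝ → ℝ≥0∞, Measurable H ∧
    (∀ᶠ T : ℝ in atTop, ∫⁻ s in Ioc 0 T, H s ≤ ENNReal.ofReal (ε * T)) ∧
    ∀ᶠ s : ℝ in atTop, ∀ τ ∈ Icc (s - r) s, D τ ≤ H s

lemma lintegral_Ioc_shift_le (H : ℝ → ℝ≥0∞) {η : ℝ} (hη : 0 ≤ η) (T : ℝ) :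
    ∫⁻ s in Ioc 0 T, (Ioi 0).indicator H (s - η) ≤ ∫⁻ s in Ioc 0 T, H s := by
  calc _ = ∫⁻ s, (Ioc 0 T).indicator (fun s => (Ioi 0).indicator H (s - η)) s :=
        (lintegral_indicator measurableSet_Ioc _).symm
    _ ≤ ∫⁻ s, (Ioc 0 T).indicator H (s - η) := by
        refine lintegral_mono fun s => ?_
        by_cases h1 : s ∈ Ioc 0 T
        · by_cases h2 : s - η ∈ Ioi 0
          · have h3 : s - η ∈ Ioc 0 T := ⟨h2, by linarith [h1.2]⟩
            simp [h1, h2, h3]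
          · simp only [indicator_of_mem h1, indicator_of_notMem h2, zero_le]
        · simp [h1]
    _ = ∫⁻ s, (Ioc 0 T).indicator H s := lintegral_sub_right_eq_self _ η
    _ = _ := lintegral_indicator measurableSet_Ioc _

namespace WindowMeanNull

variable {r : ℝ} {D D₁ D₂ : ℝ → ℝ≥0∞}

lemma mono (h : WindowMeanNull r D₂) (hle : ∀ᶠ τ in atTop, D₁ τ ≤ D₂ τ) :
    WindowMeanNull r D₁ := by
  intro ε hε
  obtain ⟨H, hH, hT, hs⟩ := h ε hε
  refine ⟨H, hH, hT, ?_⟩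
  obtain ⟨a, ha⟩ := eventually_atTop.1 hle
  filter_upwards [hs, eventually_ge_atTop (a + r)] with s h1 h2 τ hτ
  exact (ha τ (by linarith [hτ.1])).trans (h1 τ hτ)

lemma add (h₁ : WindowMeanNull r D₁) (h₂ : WindowMeanNull r D₂) :
    WindowMeanNull r (fun τ => D₁ τ + D₂ τ) := by
  intro ε hε
  obtain ⟨H, hH, hT, hs⟩ := h₁ (ε / 2) (by positivity)
  obtain ⟨K, hK, hT', hs'⟩ := h₂ (ε / 2) (by positivity)
  refine ⟨fun s => H s + K s, hH.add hK, ?_, ?_⟩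
  · filter_upwards [hT, hT', eventually_ge_atTop 0] with T a b hT0
    rw [lintegral_add_left hH]
    refine (add_le_add a b).trans ?_
    rw [← ENNReal.ofReal_add (by positivity) (by positivity)]
    exact ENNReal.ofReal_le_ofReal (by linarith)
  · filter_upwards [hs, hs'] with s a b τ hτ
    exact add_le_add (a τ hτ) (b τ hτ)

lemma const_mul (h : WindowMeanNull r D) {c : ℝ} (hc : 0 ≤ c) :
    WindowMeanNull r (fun τ => ENNReal.ofReal c * D τ) := by
  intro ε hε
  obtain ⟨H, hH, hT, hs⟩ := h (ε / (c + 1)) (by positivity)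
  refine ⟨fun s => ENNReal.ofReal c * H s, hH.const_mul _, ?_, ?_⟩
  · filter_upwards [hT, eventually_ge_atTop 0] with T a hT0
    rw [lintegral_const_mul _ hH]
    refine (mul_le_mul_right a _).trans ?_
    rw [← ENNReal.ofReal_mul hc]
    refine ENNReal.ofReal_le_ofReal ?_
    have : c * (ε / (c + 1) * T) = (c / (c + 1)) * (ε * T) := by ring
    rw [this]
    exact mul_le_of_le_one_left (by positivity) ((div_le_one (by positivity)).2 (by linarith))
  · filter_upwards [hs] with s a τ hτ
    exact mul_le_mul_right (a τ hτ) _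

lemma of_forall_le_add (h : ∀ ε : ℝ, 0 < ε → ∃ D', WindowMeanNull r D' ∧
    ∀ᶠ τ in atTop, D τ ≤ D' τ + ENNReal.ofReal ε) : WindowMeanNull r D := by
  intro ε hε
  obtain ⟨D', hD', hle⟩ := h (ε / 2) (by positivity)
  obtain ⟨H, hH, hT, hs⟩ := hD' (ε / 2) (by positivity)
  refine ⟨fun s => H s + ENNReal.ofReal (ε / 2), hH.add_const _, ?_, ?_⟩
  · filter_upwards [hT, eventually_ge_atTop 0] with T a hT0
    rw [lintegral_add_left hH, setLIntegral_const, Real.volume_Ioc, sub_zero,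
      ← ENNReal.ofReal_mul (by positivity)]
    refine (add_le_add_left a _).trans ?_
    rw [← ENNReal.ofReal_add (by positivity) (by positivity)]
    exact ENNReal.ofReal_le_ofReal (by linarith)
  · obtain ⟨a, ha⟩ := eventually_atTop.1 hle
    filter_upwards [hs, eventually_ge_atTop (a + r)] with s h1 h2 τ hτ
    exact (ha τ (by linarith [hτ.1])).trans (add_le_add_left (h1 τ hτ) _)

lemma zero : WindowMeanNull r (fun _ => 0) := fun ε _ =>
  ⟨fun _ => 0, measurable_const, by simp, by simp⟩

lemma of_tendsto (h : Tendsto D atTop (nhds 0)) : WindowMeanNull r D :=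
  of_forall_le_add fun ε hε => ⟨fun _ => 0, zero, by
    filter_upwards [h.eventually_le_const (ENNReal.ofReal_pos.2 hε)] with τ hτ
    simpa using hτ⟩

lemma iSup_window (hr : 0 ≤ r) (h : WindowMeanNull r D) :
    WindowMeanNull r (fun τ => ⨆ θ ∈ Icc (τ - r) τ, D θ) := by
  intro ε hε
  obtain ⟨H, hH, hT, hs⟩ := h (ε / 2) (by positivity)
  refine ⟨fun s => H s + (Ioi 0).indicator H (s - r),
    hH.add ((hH.indicator measurableSet_Ioi).comp (measurable_id.sub_const r)), ?_, ?_⟩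
  · filter_upwards [hT, eventually_ge_atTop 0] with T a hT0
    rw [lintegral_add_left hH]
    refine (add_le_add a ((lintegral_Ioc_shift_le H hr T).trans a)).trans ?_
    rw [← ENNReal.ofReal_add (by positivity) (by positivity)]
    exact ENNReal.ofReal_le_ofReal (by linarith)
  · obtain ⟨a, ha⟩ := eventually_atTop.1 hs
    filter_upwards [eventually_ge_atTop (a + r), eventually_ge_atTop a,
      eventually_gt_atTop r] with s h1 h2 h3 τ hτ
    refine iSup₂_le fun θ hθ => ?_
    rcases le_total (s - r) θ with h | h
    · exact (ha s h2 θ ⟨h, hθ.2.trans hτ.2⟩).trans le_self_add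
    · have h4 : s - r ∈ Ioi (0 : ℝ) := by simpa using h3
      rw [indicator_of_mem h4]
      exact (ha (s - r) (by linarith) θ ⟨by linarith [hθ.1, hτ.1], h⟩).trans le_add_self

lemma exists_forall_le (h : WindowMeanNull r D) {B : ℝ≥0∞} (hB : B ≠ ∞)
    (hDB : ∀ τ, 0 ≤ τ → D τ ≤ B) {ε : ℝ} (hε : 0 < ε) :
    ∃ H : ℝ → ℝ≥0∞, Measurable H ∧
      (∀ᶠ T : ℝ in atTop, ∫⁻ s in Ioc 0 T, H s ≤ ENNReal.ofReal (ε * T)) ∧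
      ∀ s, ∀ τ ∈ Icc (s - r) s, 0 ≤ τ → D τ ≤ H s := by
  obtain ⟨H, hH, hT, hs⟩ := h (ε / 2) (by positivity)
  obtain ⟨a, ha⟩ := eventually_atTop.1 hs
  have hm : Measurable ((Iic a).indicator (fun _ : ℝ => B)) :=
    measurable_const.indicator measurableSet_Iic
  refine ⟨fun s => H s + (Iic a).indicator (fun _ => B) s, hH.add hm, ?_, ?_⟩
  · filter_upwards [hT, eventually_ge_atTop 0,
      eventually_ge_atTop ((B * ENNReal.ofReal a).toReal / (ε / 2))] with T b hT0 hT1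
    rw [lintegral_add_left hH]
    have h1 : ∫⁻ s in Ioc 0 T, (Iic a).indicator (fun _ => B) s ≤ ENNReal.ofReal (ε / 2 * T) := by
      calc _ = ∫⁻ s in Iic a ∩ Ioc 0 T, B := by
            rw [lintegral_indicator measurableSet_Iic, Measure.restrict_restrict measurableSet_Iic]
        _ ≤ ∫⁻ s in Ioc 0 a, B := lintegral_mono_set fun s hs => ⟨hs.2.1, hs.1⟩
        _ = B * ENNReal.ofReal a := by rw [setLIntegral_const, Real.volume_Ioc, sub_zero]
        _ = ENNReal.ofReal (B * ENNReal.ofReal a).toReal :=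
            (ENNReal.ofReal_toReal (ENNReal.mul_ne_top hB ENNReal.ofReal_ne_top)).symm
        _ ≤ _ := by
            refine ENNReal.ofReal_le_ofReal ?_
            rw [div_le_iff₀ (by positivity)] at hT1
            linarith
    refine (add_le_add b h1).trans ?_
    rw [← ENNReal.ofReal_add (by positivity) (by positivity)]
    exact ENNReal.ofReal_le_ofReal (by linarith)
  · intro s τ hτ hτ0
    rcases le_total a s with h | h
    · exact (ha s h τ hτ).trans le_self_add
    · have h' : s ∈ Iic a := h
      simp only [indicator_of_mem h']
      exact (hDB τ hτ0).trans le_add_self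

lemma convolution (h : WindowMeanNull r D) {B : ℝ≥0∞} (hB : B ≠ ∞)
    (hDB : ∀ τ, 0 ≤ τ → D τ ≤ B) {k : ℝ → ℝ≥0∞} (hk : Measurable k)
    (hkint : ∫⁻ t in Ici 0, k t ≠ ∞) :
    WindowMeanNull r (fun τ => ∫⁻ σ in Ioc 0 τ, k (τ - σ) * D σ) := by
  intro ε hε
  set κ := (∫⁻ t in Ici 0, k t).toReal with hκ
  have hκ0 : 0 ≤ κ := ENNReal.toReal_nonneg
  obtain ⟨H, hH, hT, hs⟩ := h.exists_forall_le hB hDB (ε := ε / (κ + 1)) (by positivity)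
  have hmeas : Measurable (fun p : ℝ × ℝ => k p.2 * (Ioi 0).indicator H (p.1 - p.2)) :=
    (hk.comp measurable_snd).mul
      ((hH.indicator measurableSet_Ioi).comp (measurable_fst.sub measurable_snd))
  refine ⟨fun s => ∫⁻ η in Ici 0, k η * (Ioi 0).indicator H (s - η),
    hmeas.lintegral_prod_right', ?_, ?_⟩
  · filter_upwards [hT, eventually_ge_atTop 0] with T a hT0
    rw [lintegral_lintegral_swap hmeas.aemeasurable]
    calc _ ≤ ∫⁻ η in Ici 0, k η * ENNReal.ofReal (ε / (κ + 1) * T) := by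
          refine setLIntegral_mono' measurableSet_Ici fun η hη => ?_
          have hm : Measurable fun s => (Ioi 0).indicator H (s - η) :=
            (hH.indicator measurableSet_Ioi).comp (measurable_id.sub_const η)
          rw [lintegral_const_mul _ hm]
          exact mul_le_mul_right ((lintegral_Ioc_shift_le H hη T).trans a) _
      _ = ENNReal.ofReal κ * ENNReal.ofReal (ε / (κ + 1) * T) := by
          rw [lintegral_mul_const _ hk, hκ, ENNReal.ofReal_toReal hkint]
      _ ≤ _ := by
          rw [← ENNReal.ofReal_mul hκ0]
          refine ENNReal.ofReal_le_ofReal ?_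
          have : κ * (ε / (κ + 1) * T) = (κ / (κ + 1)) * (ε * T) := by ring
          rw [this]
          exact mul_le_of_le_one_left (by positivity)
            ((div_le_one (by positivity)).2 (by linarith))
  · refine Eventually.of_forall fun s τ hτ => ?_
    calc _ = ∫⁻ σ, (Ioc 0 τ).indicator (fun σ => k (τ - σ) * D σ) σ :=
          (lintegral_indicator measurableSet_Ioc _).symm
      _ = ∫⁻ η, (Ioc 0 τ).indicator (fun σ => k (τ - σ) * D σ) (τ - η) :=
          (lintegral_sub_left_eq_self _ τ).symm
      _ ≤ ∫⁻ η, (Ici 0).indicator (fun η => k η * (Ioi 0).indicator H (s - η)) η := by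
          refine lintegral_mono fun η => ?_
          by_cases h1 : τ - η ∈ Ioc 0 τ
          · have h2 : η ∈ Ici 0 := by have := h1.2; simp at this ⊢; linarith
            have h3 : s - η ∈ Ioi 0 := by have := h1.1; have := hτ.2; simp at *; linarith
            simp only [indicator_of_mem h1, indicator_of_mem h2, indicator_of_mem h3,
              sub_sub_cancel]
            exact mul_le_mul_right (hs _ _ ⟨by linarith [hτ.1], by linarith [hτ.2]⟩ h1.1.le) _
          · simp [h1]
      _ = _ := lintegral_indicator measurableSet_Ici _

end WindowMeanNull

lemma Real.le_biSup_of_nonneg {ι : Type*} {s : Set ι} {f : ι → ℝ} {b : ℝ}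
    (h0 : ∀ i ∈ s, 0 ≤ f i) (hb : ∀ i ∈ s, f i ≤ b) {i : ι} (hi : i ∈ s) :
    f i ≤ ⨆ i ∈ s, f i := by
  have hb0 : 0 ≤ b := (h0 i hi).trans (hb i hi)
  have h : BddAbove (range fun i => ⨆ _ : i ∈ s, f i) :=
    ⟨b, by rintro _ ⟨j, rfl⟩; exact Real.iSup_le (fun hj => hb j hj) hb0⟩
  refine le_trans ?_ (le_ciSup h i)
  simp [hi]

lemma Real.biSup_le {ι : Type*} {s : Set ι} {f : ι → ℝ} {b : ℝ} (hb0 : 0 ≤ b)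
    (hb : ∀ i ∈ s, f i ≤ b) : ⨆ i ∈ s, f i ≤ b :=
  Real.iSup_le (fun i => Real.iSup_le (fun hi => hb i hi) hb0) hb0

lemma Real.biSup_nonneg {ι : Type*} {s : Set ι} {f : ι → ℝ} (h0 : ∀ i ∈ s, 0 ≤ f i) :
    0 ≤ ⨆ i ∈ s, f i :=
  Real.iSup_nonneg fun i => Real.iSup_nonneg fun hi => h0 i hi

lemma PSAPunif.windowMeanNull {E Y : Type*} [NormedAddCommGroup E] [NormedAddCommGroup Y]
    {ω r : ℝ} (hω : 0 ≤ ω) {F : ℝ → E → Y} (hF : PSAPunif ω r F)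
    (hc : ∀ x, ContinuousOn (fun t => F t x) (Ici 0)) {L B : ℝ} (hL : 0 < L)
    (hB : ∀ t, 0 ≤ t → ∀ x, ‖x‖ ≤ L → ‖F t x‖ ≤ B) :
    WindowMeanNull r (fun τ => ⨆ x ∈ {x : E | ‖x‖ ≤ L}, ‖F (τ + ω) x - F τ x‖ₑ) := by
  have hdiff : ∀ τ, 0 ≤ τ → ∀ x ∈ {x : E | ‖x‖ ≤ L}, ‖F (τ + ω) x - F τ x‖ ≤ B + B :=
    fun τ hτ x hx => (norm_sub_le _ _).trans
      (add_le_add (hB _ (by linarith) x hx) (hB _ hτ x hx))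
  have hBB : 0 ≤ B + B := (norm_nonneg _).trans (hdiff 0 le_rfl 0 (by simpa using hL.le))
  set h : ℝ → ℝ := fun τ => ⨆ x ∈ {x : E | ‖x‖ ≤ L}, ‖F (τ + ω) x - F τ x‖ with hh
  have hh0 : ∀ τ, 0 ≤ h τ := fun τ => Real.biSup_nonneg fun _ _ => norm_nonneg _
  have hhB : ∀ τ, 0 ≤ τ → h τ ≤ B + B := fun τ hτ => Real.biSup_le hBB (hdiff τ hτ)
  set Φ : ℝ → ℝ := fun s => ⨆ τ ∈ Icc (s - r) s, h τ with hΦ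
  have hΦ0 : ∀ s, 0 ≤ Φ s := fun s => Real.biSup_nonneg fun τ _ => hh0 τ
  set Ψ : ℝ → ℝ≥0∞ := fun s => ⨆ θ ∈ Icc (-r) 0, ⨆ x ∈ {x : E | ‖x‖ ≤ L},
    ‖F (max (s + θ) 0 + ω) x - F (max (s + θ) 0) x‖ₑ with hΨ
  have hΨm : Measurable Ψ := by
    refine LowerSemicontinuous.measurable ?_
    refine lowerSemicontinuous_biSup fun θ _ => lowerSemicontinuous_biSup fun x _ => ?_
    refine Continuous.lowerSemicontinuous (continuous_enorm.comp ?_)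
    refine Continuous.sub ?_ ?_
    · exact (hc x).comp_continuous (f := fun s => max (s + θ) 0 + ω) (by fun_prop)
        fun s => add_nonneg (le_max_right _ _) hω
    · exact (hc x).comp_continuous (f := fun s => max (s + θ) 0) (by fun_prop)
        fun s => mem_Ici.2 (le_max_right _ _)
  have hΨΦ : ∀ s, r ≤ s → Ψ s = ENNReal.ofReal (Φ s) := by
    intro s hs
    have hτ0 : ∀ τ ∈ Icc (s - r) s, 0 ≤ τ := fun τ hτ => by linarith [hτ.1]
    have hle : Ψ s ≤ ENNReal.ofReal (Φ s) := by
      refine iSup₂_le fun θ hθ => iSup₂_le fun x hx => ?_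
      have hτ : s + θ ∈ Icc (s - r) s := ⟨by linarith [hθ.1], by linarith [hθ.2]⟩
      rw [max_eq_left (hτ0 _ hτ), ← ofReal_norm]
      refine ENNReal.ofReal_le_ofReal ?_
      calc _ ≤ h (s + θ) := Real.le_biSup_of_nonneg
              (f := fun x => ‖F (s + θ + ω) x - F (s + θ) x‖)
              (fun _ _ => norm_nonneg _) (hdiff _ (hτ0 _ hτ)) hx
        _ ≤ Φ s := Real.le_biSup_of_nonneg (fun τ _ => hh0 τ)
              (fun τ hτ => hhB τ (hτ0 τ hτ)) hτ
    refine le_antisymm hle ?_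
    have hfin : Ψ s ≠ ∞ := ne_top_of_le_ne_top ENNReal.ofReal_ne_top hle
    rw [ENNReal.ofReal_le_iff_le_toReal hfin]
    refine Real.biSup_le ENNReal.toReal_nonneg fun τ hτ =>
      Real.biSup_le ENNReal.toReal_nonneg fun x hx => ?_
    rw [← ENNReal.ofReal_le_iff_le_toReal hfin, ofReal_norm]
    refine le_trans ?_ (le_iSup₂_of_le (τ - s) ⟨by linarith [hτ.1], by linarith [hτ.2]⟩
      (le_iSup₂_of_le x hx le_rfl))
    rw [add_sub_cancel, max_eq_left (hτ0 τ hτ)]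
  have hΨB : ∀ s, r ≤ s → Ψ s ≤ ENNReal.ofReal (B + B) := fun s hs => by
    rw [hΨΦ s hs]
    exact ENNReal.ofReal_le_ofReal
      (Real.biSup_le hBB fun τ hτ => hhB τ (by linarith [hτ.1]))
  intro ε hε
  refine ⟨(Ioi r).indicator Ψ, hΨm.indicator measurableSet_Ioi, ?_, ?_⟩
  · filter_upwards [(hF L hL).eventually_le_const hε, eventually_gt_atTop r,
      eventually_gt_atTop 0] with T hT hrT hT0
    have hlt : ∫⁻ s in Ioc r T, Ψ s ≠ ∞ := by
      refine ne_top_of_le_ne_top (b := ENNReal.ofReal (B + B) * volume (Ioc r T))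
        (ENNReal.mul_ne_top ENNReal.ofReal_ne_top (by simp)) ?_
      rw [← setLIntegral_const]
      exact setLIntegral_mono' measurableSet_Ioc fun s hs => hΨB s hs.1.le
    have hint : ∫ s in r..T, Φ s = (∫⁻ s in Ioc r T, Ψ s).toReal := by
      rw [intervalIntegral.integral_of_le hrT.le, ← integral_toReal hΨm.aemeasurable]
      · refine setIntegral_congr_fun measurableSet_Ioc fun s hs => ?_
        simp only [hΨΦ s hs.1.le, ENNReal.toReal_ofReal (hΦ0 s)]
      · refine (ae_restrict_iff' measurableSet_Ioc).2 (Eventually.of_forall fun s hs => ?_)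
        exact (hΨB s hs.1.le).trans_lt ENNReal.ofReal_lt_top
    calc _ ≤ ∫⁻ s in Ioc r T, Ψ s := by
          rw [lintegral_indicator measurableSet_Ioi, Measure.restrict_restrict measurableSet_Ioi]
          exact lintegral_mono_set fun s hs => ⟨hs.1, hs.2.2⟩
      _ = ENNReal.ofReal (∫ s in r..T, Φ s) := by rw [hint, ENNReal.ofReal_toReal hlt]
      _ ≤ _ := by
          refine ENNReal.ofReal_le_ofReal ?_
          have : 1 / T * ∫ s in r..T, Φ s ≤ ε := hT
          rwa [one_div, inv_mul_le_iff₀ hT0, mul_comm] at this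
  · filter_upwards [eventually_gt_atTop r] with s hs τ hτ
    rw [indicator_of_mem (show s ∈ Ioi r from hs)]
    refine iSup₂_le fun x hx => ?_
    refine le_trans ?_ (le_iSup₂_of_le (τ - s) ⟨by linarith [hτ.1], by linarith [hτ.2]⟩
      (le_iSup₂_of_le x hx le_rfl))
    rw [add_sub_cancel, max_eq_left (by linarith [hτ.1])]

lemma WindowMeanNull.psapClass {Y : Type*} [NormedAddCommGroup Y] {ω r B : ℝ} (hr : 0 ≤ r)
    (hω : 0 ≤ ω) {v : ℝ → Y} (hv : WindowMeanNull r (fun τ => ‖v (τ + ω) - v τ‖ₑ))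
    (hB : ∀ t, 0 ≤ t → ‖v t‖ ≤ B) : PSAPclass ω r v := by
  have hdiff : ∀ τ, 0 ≤ τ → ‖v (τ + ω) - v τ‖ₑ ≤ ENNReal.ofReal (B + B) := fun τ hτ => by
    rw [← ofReal_norm]
    exact ENNReal.ofReal_le_ofReal ((norm_sub_le _ _).trans
      (add_le_add (hB _ (by linarith)) (hB _ hτ)))
  refine Metric.tendsto_nhds.2 fun ε hε => ?_
  obtain ⟨H, -, hT, hs⟩ := hv.exists_forall_le ENNReal.ofReal_ne_top hdiff (half_pos hε)
  filter_upwards [hT, eventually_gt_atTop r, eventually_gt_atTop 0] with T hT hrT hT0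
  set Φ : ℝ → ℝ := fun s => ⨆ τ ∈ Icc (s - r) s, ‖v (τ + ω) - v τ‖ with hΦ
  have hΦ0 : ∀ s, 0 ≤ Φ s := fun s => Real.biSup_nonneg fun _ _ => norm_nonneg _
  have hint : ‖∫ s in r..T, Φ s‖ ≤ ε / 2 * T := by
    rw [← ENNReal.ofReal_le_ofReal_iff (by positivity), ofReal_norm,
      intervalIntegral.integral_of_le hrT.le]
    calc _ ≤ ∫⁻ s in Ioc r T, ‖Φ s‖ₑ := enorm_integral_le_lintegral_enorm _
      _ ≤ ∫⁻ s in Ioc r T, H s := by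
          refine setLIntegral_mono' measurableSet_Ioc fun s hrs => ?_
          rw [Real.enorm_of_nonneg (hΦ0 s)]
          by_cases htop : H s = ∞
          · simp [htop]
          rw [ENNReal.ofReal_le_iff_le_toReal htop]
          refine Real.biSup_le ENNReal.toReal_nonneg fun τ hτ => ?_
          rw [← ENNReal.ofReal_le_iff_le_toReal htop, ofReal_norm]
          exact hs s τ hτ (by linarith [hτ.1, hrs.1])
      _ ≤ ∫⁻ s in Ioc 0 T, H s := lintegral_mono_set (Ioc_subset_Ioc_left hr)
      _ ≤ _ := hT
  rw [dist_zero_right, norm_mul, Real.norm_of_nonneg (by positivity), one_div,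
    inv_mul_lt_iff₀ hT0]
  exact hint.trans_lt (by nlinarith)

section History

variable {X : Type*} [NormedAddCommGroup X] {r : ℝ}

lemma hist_apply_of_continuousOn {u : ℝ → X} (hu : ContinuousOn u (Ici (-r))) {t : ℝ}
    (ht : 0 ≤ t) (θ : Icc (-r) (0 : ℝ)) : hist r u t θ = u (t + θ) := by
  have h : Continuous (fun θ : Icc (-r) (0 : ℝ) => u (t + θ)) :=
    hu.comp_continuous (by fun_prop) fun θ => by
      have := θ.2.1
      simp only [mem_Ici]
      linarith
  simp [hist, h]

lemma hist_apply {u : ℝ → X} (hu : Continuous u) (t : ℝ) (θ : Icc (-r) (0 : ℝ)) :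
    hist r u t θ = u (t + θ) := by
  have h : Continuous (fun θ : Icc (-r) (0 : ℝ) => u (t + θ)) := by fun_prop
  simp [hist, h]

lemma continuous_hist {u : ℝ → X} (hu : Continuous u) : Continuous (hist r u) := by
  have h : hist r u = ContinuousMap.curry
      ⟨fun p : ℝ × Icc (-r) (0 : ℝ) => u (p.1 + p.2), by fun_prop⟩ := by
    ext t θ
    simp [hist_apply hu]
  rw [h]
  exact ContinuousMap.continuous _

lemma norm_hist_le {u : ℝ → X} (hu : Continuous u) {B : ℝ} (hB0 : 0 ≤ B) (hB : ∀ t, ‖u t‖ ≤ B)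
    (t : ℝ) : ‖hist r u t‖ ≤ B :=
  (ContinuousMap.norm_le _ hB0).2 fun θ => by
    rw [hist_apply hu]
    exact hB _

lemma norm_hist_sub_le {u v : ℝ → X} (hu : Continuous u) (hv : Continuous v) {d : ℝ}
    (hd0 : 0 ≤ d) (hd : ∀ t, ‖u t - v t‖ ≤ d) (t : ℝ) : ‖hist r u t - hist r v t‖ ≤ d :=
  (ContinuousMap.norm_le _ hd0).2 fun θ => by
    rw [ContinuousMap.sub_apply, hist_apply hu, hist_apply hv]
    exact hd _

lemma enorm_hist_sub_le {u : ℝ → X} (hu : Continuous u) (ω t : ℝ) :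
    ‖hist r u (t + ω) - hist r u t‖ₑ ≤ ⨆ τ ∈ Icc (t - r) t, ‖u (τ + ω) - u τ‖ₑ := by
  by_cases htop : (⨆ τ ∈ Icc (t - r) t, ‖u (τ + ω) - u τ‖ₑ) = ∞
  · rw [htop]
    exact le_top
  rw [← ofReal_norm, ENNReal.ofReal_le_iff_le_toReal htop,
    ContinuousMap.norm_le _ ENNReal.toReal_nonneg]
  intro θ
  rw [← ENNReal.ofReal_le_iff_le_toReal htop, ofReal_norm, ContinuousMap.sub_apply,
    hist_apply hu, hist_apply hu]
  refine le_iSup₂_of_le (t + θ) ⟨by linarith [θ.2.1], by linarith [θ.2.2]⟩ ?_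
  rw [add_right_comm]

end History

section Convolution

variable {X : Type*} [NormedAddCommGroup X] [NormedSpace ℝ X] {S : ℝ → X →L[ℝ] X} {k : ℝ → ℝ}

lemma continuous_strong_apply (hS : ∀ x, Continuous fun t => S t x) {K : ℝ}
    (hK : ∀ t, ‖S t‖ ≤ K) : Continuous fun p : ℝ × X => S p.1 p.2 := by
  refine continuous_iff_continuousAt.2 fun ⟨t, x⟩ => tendsto_iff_norm_sub_tendsto_zero.2 ?_
  have hlim : Tendsto (fun p : ℝ × X => K * ‖p.2 - x‖ + ‖S p.1 x - S t x‖) (nhds (t, x))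
      (nhds 0) := by
    have hc : Continuous (fun p : ℝ × X => K * ‖p.2 - x‖ + ‖S p.1 x - S t x‖) :=
      (continuous_const.mul (continuous_snd.sub continuous_const).norm).add
        (((hS x).comp continuous_fst).sub continuous_const).norm
    simpa using hc.tendsto (t, x)
  refine squeeze_zero (fun _ => norm_nonneg _) (fun p => ?_) hlim
  calc ‖S p.1 p.2 - S t x‖ = ‖S p.1 (p.2 - x) + (S p.1 x - S t x)‖ := by
        rw [map_sub]; congr 1; abel
    _ ≤ _ := (norm_add_le _ _).trans
        (add_le_add_left ((S p.1).le_of_opNorm_le (hK _) _) _)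

lemma continuous_convolution_integrand (hS : ∀ x, Continuous fun t => S t x) {K : ℝ}
    (hK : ∀ t, ‖S t‖ ≤ K) {F : ℝ → X} (hF : Continuous F) :
    Continuous fun p : ℝ × ℝ => S (p.1 - p.2) (F p.2) :=
  (continuous_strong_apply hS hK).comp
    ((continuous_fst.sub continuous_snd).prodMk (hF.comp continuous_snd))

lemma norm_convolution_le (hk : ∀ t, ‖S t‖ ≤ k t) (hkc : Continuous k) {F : ℝ → X}
    {b : ℝ → ℝ} (hb : Continuous b) (hFb : ∀ s, ‖F s‖ ≤ b s) {t : ℝ} (ht : 0 ≤ t) :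
    ‖∫ s in (0 : ℝ)..t, S (t - s) (F s)‖ ≤ ∫ s in (0 : ℝ)..t, k (t - s) * b s := by
  refine intervalIntegral.norm_integral_le_of_norm_le ht (Eventually.of_forall fun s _ => ?_)
    (Continuous.intervalIntegrable (by fun_prop) _ _)
  exact ((S (t - s)).le_opNorm _).trans
    (mul_le_mul (hk _) (hFb s) (norm_nonneg _) ((norm_nonneg _).trans (hk _)))

lemma windowMeanNull_convolution (hS : ∀ x, Continuous fun t => S t x)
    (hk : ∀ t, ‖S t‖ ≤ k t) (hkc : Continuous k) (hka : Antitone k) {K : ℝ} (hkK : ∀ t, k t ≤ K)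
    (hkint : IntegrableOn k (Ici 0)) (hk0 : Tendsto k atTop (nhds 0)) {F : ℝ → X}
    (hF : Continuous F) {B : ℝ} (hB : ∀ s, ‖F s‖ ≤ B) {r ω : ℝ} (hω : 0 ≤ ω)
    (hFn : WindowMeanNull r fun τ => ‖F (τ + ω) - F τ‖ₑ) :
    WindowMeanNull r fun τ => ‖(∫ s in (0 : ℝ)..τ + ω, S (τ + ω - s) (F s)) -
      ∫ s in (0 : ℝ)..τ, S (τ - s) (F s)‖ₑ := by
  have hkpos : ∀ t, 0 ≤ k t := fun t => (norm_nonneg _).trans (hk t)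
  have hB0 : 0 ≤ B := (norm_nonneg _).trans (hB 0)
  have hK : ∀ t, ‖S t‖ ≤ K := fun t => (hk t).trans (hkK t)
  have hJ := continuous_convolution_integrand hS hK hF
  have hcont : ∀ t, Continuous fun s => S (t - s) (F s) := fun t =>
    hJ.comp (continuous_const.prodMk continuous_id)
  have hcont' : ∀ t, Continuous fun s => S (t - s) (F (s + ω)) := fun t =>
    (continuous_convolution_integrand hS hK (F := fun s => F (s + ω)) (by fun_prop)).comp
      (continuous_const.prodMk continuous_id)
  have hhead : WindowMeanNull r fun τ => ENNReal.ofReal (k τ * B * |ω - 0|) := by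
    refine WindowMeanNull.of_tendsto ?_
    have := (hk0.mul_const B).mul_const |ω - 0|
    rw [zero_mul, zero_mul] at this
    simpa using ENNReal.tendsto_ofReal this
  have hdiffB : ∀ τ, 0 ≤ τ → ‖F (τ + ω) - F τ‖ₑ ≤ ENNReal.ofReal (B + B) := fun τ _ => by
    rw [← ofReal_norm]
    exact ENNReal.ofReal_le_ofReal ((norm_sub_le _ _).trans (add_le_add (hB _) (hB _)))
  have htail := hFn.convolution ENNReal.ofReal_ne_top hdiffB
    (k := fun t => ENNReal.ofReal (k t)) (by fun_prop) hkint.lintegral_lt_top.ne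
  refine (hhead.add htail).mono ?_
  filter_upwards [eventually_ge_atTop 0] with τ hτ
  have hsplit : (∫ s in (0 : ℝ)..τ + ω, S (τ + ω - s) (F s)) -
      ∫ s in (0 : ℝ)..τ, S (τ - s) (F s) =
      (∫ s in (0 : ℝ)..ω, S (τ + ω - s) (F s)) +
        ∫ s in (0 : ℝ)..τ, S (τ - s) (F (s + ω) - F s) := by
    have h1 : ∫ s in ω..τ + ω, S (τ + ω - s) (F s) =
        ∫ s in (0 : ℝ)..τ, S (τ - s) (F (s + ω)) := by
      have := intervalIntegral.integral_comp_add_right (a := 0) (b := τ)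
        (fun s => S (τ + ω - s) (F s)) ω
      rw [zero_add] at this
      rw [← this]
      refine intervalIntegral.integral_congr fun s _ => ?_
      simp only [add_sub_add_right_eq_sub]
    have h2 := intervalIntegral.integral_add_adjacent_intervals
      ((hcont (τ + ω)).intervalIntegrable (μ := volume) 0 ω)
      ((hcont (τ + ω)).intervalIntegrable ω (τ + ω))
    simp only [map_sub]
    rw [intervalIntegral.integral_sub ((hcont' τ).intervalIntegrable _ _)
      ((hcont τ).intervalIntegrable _ _), ← h2, h1]
    abel
  rw [hsplit]
  refine (enorm_add_le _ _).trans (add_le_add ?_ ?_)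
  · rw [← ofReal_norm]
    refine ENNReal.ofReal_le_ofReal
      (intervalIntegral.norm_integral_le_of_norm_le_const fun s hs => ?_)
    rw [uIoc_of_le hω] at hs
    exact ((S _).le_opNorm _).trans (mul_le_mul ((hk _).trans (hka (by linarith [hs.2])))
      (hB s) (norm_nonneg _) (hkpos _))
  · rw [intervalIntegral.integral_of_le hτ]
    refine (enorm_integral_le_lintegral_enorm _).trans (lintegral_mono fun s => ?_)
    rw [← ofReal_norm, ← ofReal_norm, ← ENNReal.ofReal_mul (hkpos _)]
    exact ENNReal.ofReal_le_ofReal ((S _).le_of_opNorm_le (hk _) _)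

end Convolution

/-- The right-hand side of the mild formulation. -/
noncomputable def mildMap {X : Type*} [NormedAddCommGroup X] [NormedSpace ℝ X] (r : ℝ)
    (S : ℝ → X →L[ℝ] X) (x₀ : X) (g f : ℝ → C(Icc (-r) (0 : ℝ), X) → X) (w : ℝ → X) (t : ℝ) : X :=
  S t x₀ + g t (hist r w t) + ∫ s in (0 : ℝ)..t, S (t - s) (f s (hist r w s))

/-- The hypotheses on the data, with every function of time defined and regular on all of `ℝ`. -/
structure MildData {X : Type*} [NormedAddCommGroup X] [NormedSpace ℝ X] (r ω q : ℝ)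
    (S : ℝ → X →L[ℝ] X) (k Lg Lf : ℝ → ℝ) (g f : ℝ → C(Icc (-r) (0 : ℝ), X) → X) : Prop where
  r_nonneg : 0 ≤ r
  omega_nonneg : 0 ≤ ω
  continuous_S : ∀ x, Continuous fun t => S t x
  norm_S_le : ∀ t, ‖S t‖ ≤ k t
  continuous_k : Continuous k
  antitone_k : Antitone k
  exists_k_le : ∃ K, ∀ t, k t ≤ K
  integrable_k : IntegrableOn k (Ici 0)
  tendsto_k : Tendsto k atTop (nhds 0)
  continuous_g : Continuous fun p : ℝ × C(Icc (-r) (0 : ℝ), X) => g p.1 p.2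
  continuous_f : Continuous fun p : ℝ × C(Icc (-r) (0 : ℝ), X) => f p.1 p.2
  exists_g_le : ∃ B, ∀ t, ‖g t 0‖ ≤ B
  exists_f_le : ∃ B, ∀ t, ‖f t 0‖ ≤ B
  exists_Lg_le : ∃ B, ∀ t, Lg t ≤ B
  exists_Lf_le : ∃ B, ∀ t, Lf t ≤ B
  Lg_nonneg : ∀ t, 0 ≤ Lg t
  Lf_nonneg : ∀ t, 0 ≤ Lf t
  continuous_Lf : Continuous Lf
  lipschitz_g : ∀ t ψ₁ ψ₂, ‖g t ψ₁ - g t ψ₂‖ ≤ Lg t * ‖ψ₁ - ψ₂‖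
  lipschitz_f : ∀ t ψ₁ ψ₂, ‖f t ψ₁ - f t ψ₂‖ ≤ Lf t * ‖ψ₁ - ψ₂‖
  psap_g : PSAPunif ω r g
  psap_f : PSAPunif ω r f
  contraction : ∀ t, 0 ≤ t → (∫ s in (0 : ℝ)..t, k (t - s) * Lf s) + Lg t ≤ q

section Superposition

variable {X : Type*} [NormedAddCommGroup X] {r : ℝ}
  {f : ℝ → C(Icc (-r) (0 : ℝ), X) → X}

lemma exists_norm_le_of_lipschitz {L : ℝ → ℝ} (h0 : ∃ B, ∀ t, ‖f t 0‖ ≤ B)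
    (hL : ∃ B, ∀ t, L t ≤ B) (hlip : ∀ t ψ₁ ψ₂, ‖f t ψ₁ - f t ψ₂‖ ≤ L t * ‖ψ₁ - ψ₂‖) (R : ℝ) :
    ∃ B, ∀ t ψ, ‖ψ‖ ≤ R → ‖f t ψ‖ ≤ B := by
  obtain ⟨B₀, hB₀⟩ := h0
  obtain ⟨B₁, hB₁⟩ := hL
  refine ⟨max B₁ 0 * R + B₀, fun t ψ hψ => ?_⟩
  calc ‖f t ψ‖ = ‖(f t ψ - f t 0) + f t 0‖ := by rw [sub_add_cancel]
    _ ≤ L t * ‖ψ - 0‖ + B₀ := (norm_add_le _ _).trans (add_le_add (hlip t ψ 0) (hB₀ t))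
    _ ≤ _ := by
      rw [sub_zero]
      gcongr
      exact (hB₁ t).trans (le_max_left _ _)

lemma continuous_superposition
    (hf : Continuous fun p : ℝ × C(Icc (-r) (0 : ℝ), X) => f p.1 p.2) {w : ℝ → X}
    (hw : Continuous w) : Continuous fun t => f t (hist r w t) :=
  hf.comp (continuous_id.prodMk (continuous_hist hw))

lemma windowMeanNull_superposition {ω : ℝ} (hr : 0 ≤ r) (hω : 0 ≤ ω)
    (hf : Continuous fun p : ℝ × C(Icc (-r) (0 : ℝ), X) => f p.1 p.2) {L : ℝ → ℝ}
    (h0 : ∃ B, ∀ t, ‖f t 0‖ ≤ B) (hL : ∃ B, ∀ t, L t ≤ B)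
    (hlip : ∀ t ψ₁ ψ₂, ‖f t ψ₁ - f t ψ₂‖ ≤ L t * ‖ψ₁ - ψ₂‖) (hP : PSAPunif ω r f) {w : ℝ → X}
    (hw : Continuous w) {B : ℝ} (hB : ∀ t, ‖w t‖ ≤ B)
    (hwn : WindowMeanNull r fun τ => ‖w (τ + ω) - w τ‖ₑ) :
    WindowMeanNull r fun τ => ‖f (τ + ω) (hist r w (τ + ω)) - f τ (hist r w τ)‖ₑ := by
  have hB0 : 0 ≤ B := (norm_nonneg _).trans (hB 0)
  obtain ⟨B₁, hB₁⟩ := hL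
  obtain ⟨B₂, hB₂⟩ := exists_norm_le_of_lipschitz h0 ⟨B₁, hB₁⟩ hlip (B + 1)
  have h1 := hP.windowMeanNull hω
    (fun x => (hf.comp (continuous_id.prodMk continuous_const)).continuousOn)
    (L := B + 1) (B := B₂) (by positivity) (fun t _ x hx => hB₂ t x hx)
  have h2 := (hwn.iSup_window hr).const_mul (le_max_right B₁ 0)
  refine (h1.add h2).mono (Eventually.of_forall fun τ => ?_)
  have hsplit : f (τ + ω) (hist r w (τ + ω)) - f τ (hist r w τ) =
      (f (τ + ω) (hist r w (τ + ω)) - f τ (hist r w (τ + ω))) +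
        (f τ (hist r w (τ + ω)) - f τ (hist r w τ)) := by abel
  rw [hsplit]
  refine (enorm_add_le _ _).trans (add_le_add ?_ ?_)
  · have hmem : hist r w (τ + ω) ∈ {x : C(Icc (-r) (0 : ℝ), X) | ‖x‖ ≤ B + 1} :=
      (norm_hist_le hw hB0 hB _).trans (by linarith)
    exact le_iSup₂_of_le (f := fun x (_ : x ∈ {x : C(Icc (-r) (0 : ℝ), X) | ‖x‖ ≤ B + 1}) =>
      ‖f (τ + ω) x - f τ x‖ₑ) _ hmem le_rfl
  · refine le_trans ?_ (mul_le_mul_right (enorm_hist_sub_le hw ω τ) _)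
    rw [← ofReal_norm, ← ofReal_norm, ← ENNReal.ofReal_mul (le_max_right _ _)]
    refine ENNReal.ofReal_le_ofReal ((hlip _ _ _).trans ?_)
    gcongr
    exact (hB₁ τ).trans (le_max_left _ _)

end Superposition

namespace MildData

variable {X : Type*} [NormedAddCommGroup X] [NormedSpace ℝ X] {r ω q : ℝ}
  {S : ℝ → X →L[ℝ] X} {k Lg Lf : ℝ → ℝ} {g f : ℝ → C(Icc (-r) (0 : ℝ), X) → X}

lemma k_nonneg (h : MildData r ω q S k Lg Lf g f) (t : ℝ) : 0 ≤ k t :=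
  (norm_nonneg _).trans (h.norm_S_le t)

lemma exists_norm_S_le (h : MildData r ω q S k Lg Lf g f) : ∃ K, ∀ t, ‖S t‖ ≤ K :=
  h.exists_k_le.imp fun _ hK t => (h.norm_S_le t).trans (hK t)

lemma continuous_mildMap (h : MildData r ω q S k Lg Lf g f) (x₀ : X) {w : ℝ → X}
    (hw : Continuous w) : Continuous (mildMap r S x₀ g f w) := by
  obtain ⟨K, hK⟩ := h.exists_norm_S_le
  refine ((h.continuous_S x₀).add (continuous_superposition h.continuous_g hw)).add ?_
  exact intervalIntegral.continuous_parametric_intervalIntegral_of_continuous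
    (f := fun t s => S (t - s) (f s (hist r w s)))
    (continuous_convolution_integrand h.continuous_S hK
      (continuous_superposition h.continuous_f hw)) continuous_id

lemma exists_norm_mildMap_le (h : MildData r ω q S k Lg Lf g f) (x₀ : X) {w : ℝ → X}
    (hw : Continuous w) {B : ℝ} (hB : ∀ t, ‖w t‖ ≤ B) :
    ∃ B', ∀ t, 0 ≤ t → ‖mildMap r S x₀ g f w t‖ ≤ B' := by
  have hB0 : 0 ≤ B := (norm_nonneg _).trans (hB 0)
  obtain ⟨K, hK⟩ := h.exists_k_le
  obtain ⟨Bg, hBg⟩ := exists_norm_le_of_lipschitz h.exists_g_le h.exists_Lg_le h.lipschitz_g B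
  obtain ⟨Bf, hBf⟩ := exists_norm_le_of_lipschitz h.exists_f_le h.exists_Lf_le h.lipschitz_f B
  have hhist := norm_hist_le (r := r) hw hB0 hB
  have hBf0 : 0 ≤ Bf := (norm_nonneg _).trans (hBf 0 _ (hhist 0))
  refine ⟨K * ‖x₀‖ + Bg + (∫ s in Ici 0, k s) * Bf, fun t ht => ?_⟩
  refine norm_add₃_le.trans (add_le_add (add_le_add ?_ (hBg _ _ (hhist t))) ?_)
  · exact (S t).le_of_opNorm_le ((h.norm_S_le t).trans (hK t)) _
  · refine (norm_convolution_le h.norm_S_le h.continuous_k (b := fun _ => Bf) continuous_const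
      (fun s => hBf s _ (hhist s)) ht).trans ?_
    rw [intervalIntegral.integral_mul_const, intervalIntegral.integral_comp_sub_left k t, sub_self,
      sub_zero, intervalIntegral.integral_of_le ht]
    refine mul_le_mul_of_nonneg_right ?_ hBf0
    exact setIntegral_mono_set h.integrable_k (Eventually.of_forall fun s => h.k_nonneg s)
      (Eventually.of_forall fun s (hs : s ∈ Ioc 0 t) => hs.1.le)

lemma norm_mildMap_sub_le (h : MildData r ω q S k Lg Lf g f) (x₀ : X)
    {w v : ℝ → X} (hw : Continuous w) (hv : Continuous v) {d : ℝ} (hd0 : 0 ≤ d)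
    (hd : ∀ t, ‖w t - v t‖ ≤ d) {t : ℝ} (ht : 0 ≤ t) :
    ‖mildMap r S x₀ g f w t - mildMap r S x₀ g f v t‖ ≤ q * d := by
  obtain ⟨K, hK⟩ := h.exists_norm_S_le
  have hint : ∀ {u : ℝ → X}, Continuous u →
      IntervalIntegrable (fun s => S (t - s) (f s (hist r u s))) volume 0 t := fun hu =>
    ((continuous_convolution_integrand h.continuous_S hK
      (continuous_superposition h.continuous_f hu)).comp
      (continuous_const.prodMk continuous_id)).intervalIntegrable _ _
  have hhist := norm_hist_sub_le (r := r) hw hv hd0 hd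
  have hsplit : mildMap r S x₀ g f w t - mildMap r S x₀ g f v t =
      (∫ s in (0 : ℝ)..t, S (t - s) (f s (hist r w s) - f s (hist r v s))) +
        (g t (hist r w t) - g t (hist r v t)) := by
    simp only [map_sub]
    rw [intervalIntegral.integral_sub (hint hw) (hint hv), mildMap, mildMap]
    abel
  rw [hsplit]
  have hconv := norm_convolution_le h.norm_S_le h.continuous_k
    (F := fun s => f s (hist r w s) - f s (hist r v s)) (h.continuous_Lf.mul_const d)
    (fun s => (h.lipschitz_f _ _ _).trans (mul_le_mul_of_nonneg_left (hhist s) (h.Lf_nonneg s))) ht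
  simp only [← mul_assoc, intervalIntegral.integral_mul_const] at hconv
  calc _ ≤ (∫ s in (0 : ℝ)..t, k (t - s) * Lf s) * d + Lg t * d :=
        (norm_add_le _ _).trans (add_le_add hconv ((h.lipschitz_g _ _ _).trans
          (mul_le_mul_of_nonneg_left (hhist t) (h.Lg_nonneg t))))
    _ = ((∫ s in (0 : ℝ)..t, k (t - s) * Lf s) + Lg t) * d := by ring
    _ ≤ q * d := mul_le_mul_of_nonneg_right (h.contraction t ht) hd0

lemma windowMeanNull_mildMap (h : MildData r ω q S k Lg Lf g f) (x₀ : X)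
    {w : ℝ → X} (hw : Continuous w) {B : ℝ} (hB : ∀ t, ‖w t‖ ≤ B)
    (hwn : WindowMeanNull r fun τ => ‖w (τ + ω) - w τ‖ₑ) :
    WindowMeanNull r fun τ => ‖mildMap r S x₀ g f w (τ + ω) - mildMap r S x₀ g f w τ‖ₑ := by
  have hB0 : 0 ≤ B := (norm_nonneg _).trans (hB 0)
  obtain ⟨K, hK⟩ := h.exists_k_le
  obtain ⟨Bf, hBf⟩ := exists_norm_le_of_lipschitz h.exists_f_le h.exists_Lf_le h.lipschitz_f B
  have hgn := windowMeanNull_superposition h.r_nonneg h.omega_nonneg h.continuous_g h.exists_g_le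
    h.exists_Lg_le h.lipschitz_g h.psap_g hw hB hwn
  have hfn := windowMeanNull_superposition h.r_nonneg h.omega_nonneg h.continuous_f h.exists_f_le
    h.exists_Lf_le h.lipschitz_f h.psap_f hw hB hwn
  have hcn := windowMeanNull_convolution h.continuous_S h.norm_S_le h.continuous_k h.antitone_k hK
    h.integrable_k h.tendsto_k (continuous_superposition h.continuous_f hw)
    (fun s => hBf s _ (norm_hist_le hw hB0 hB s)) h.omega_nonneg hfn
  have hSx : Tendsto (fun t => S t x₀) atTop (nhds 0) := by
    refine squeeze_zero_norm (fun t => (S t).le_of_opNorm_le (h.norm_S_le t) x₀) ?_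
    simpa using h.tendsto_k.mul_const ‖x₀‖
  have hSn : WindowMeanNull r fun τ => ‖S (τ + ω) x₀ - S τ x₀‖ₑ := by
    refine WindowMeanNull.of_tendsto ?_
    simpa using
      ((hSx.comp (tendsto_atTop_add_const_right atTop ω tendsto_id)).sub hSx).enorm
  refine ((hSn.add hgn).add hcn).mono (Eventually.of_forall fun τ => ?_)
  simp only [mildMap, add_sub_add_comm]
  exact (enorm_add_le _ _).trans (add_le_add_left (enorm_add_le _ _) _)

end MildData

lemma hist_congr {X : Type*} [NormedAddCommGroup X] {r t : ℝ} {u v : ℝ → X}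
    (h : ∀ θ : Icc (-r) (0 : ℝ), u (t + θ) = v (t + θ)) : hist r u t = hist r v t := by
  have huv : (fun θ : Icc (-r) (0 : ℝ) => u (t + θ)) =
      fun θ : Icc (-r) (0 : ℝ) => v (t + θ) := funext h
  unfold hist
  by_cases hc : Continuous fun θ : Icc (-r) (0 : ℝ) => v (t + θ)
  · rw [dif_pos (huv ▸ hc), dif_pos hc]
    exact ContinuousMap.ext h
  · rw [dif_neg (huv ▸ hc), dif_neg hc]

lemma IsMildSolution.congr {X : Type*} [NormedAddCommGroup X] [NormedSpace ℝ X] {r : ℝ}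
    {h0 : (0 : ℝ) ∈ Icc (-r) (0 : ℝ)} {S S' : ℝ → X →L[ℝ] X} {φ : C(Icc (-r) (0 : ℝ), X)}
    {g g' f f' : ℝ → C(Icc (-r) (0 : ℝ), X) → X} {u : ℝ → X}
    (hu : IsMildSolution r h0 S φ g f u) (hS : EqOn S S' (Ici 0)) (hg : EqOn g g' (Ici 0))
    (hf : EqOn f f' (Ici 0)) : IsMildSolution r h0 S' φ g' f' u := by
  refine ⟨hu.1, hu.2.1, hu.2.2.1, fun t ht => ?_⟩
  rw [hu.2.2.2 t ht, hS (mem_Ici.2 ht), hg (mem_Ici.2 ht), hg self_mem_Ici]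
  congr 1
  refine intervalIntegral.integral_congr fun s hs => ?_
  rw [uIcc_of_le ht] at hs
  simp only [hS (mem_Ici.2 (sub_nonneg.2 hs.2)), hf (mem_Ici.2 hs.1)]

theorem MildData.exists_unique_isMildSolution {X : Type*} [NormedAddCommGroup X] [NormedSpace ℝ X]
    [CompleteSpace X] {r ω q : ℝ} {S : ℝ → X →L[ℝ] X} {k Lg Lf : ℝ → ℝ}
    {g f : ℝ → C(Icc (-r) (0 : ℝ), X) → X} (h : MildData r ω q S k Lg Lf g f) (hq0 : 0 ≤ q)
    (hq1 : q < 1) (hS0 : S 0 = 1) (h0 : (0 : ℝ) ∈ Icc (-r) (0 : ℝ))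
    (φ : C(Icc (-r) (0 : ℝ), X)) :
    ∃ u : ℝ → X, (IsMildSolution r h0 S φ g f u ∧ PSAPclass ω r u) ∧
      ∀ v, IsMildSolution r h0 S φ g f v → ∀ t ≥ -r, v t = u t := by
  have hr : -r ≤ 0 := h0.1
  set φe : ℝ → X := IccExtend hr φ with hφe
  have hφc : Continuous φe := φ.continuous.Icc_extend'
  have hφb : ∀ t, ‖φe t‖ ≤ ‖φ‖ := fun t => φ.norm_coe_le_norm _
  have hφ0 : ∀ t, 0 ≤ t → φe t = φ ⟨0, h0⟩ := fun t ht => IccExtend_of_right_le hr φ ht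
  have hφθ : ∀ θ : Icc (-r) (0 : ℝ), φe θ = φ θ := fun θ => IccExtend_val hr φ θ
  set x₀ : X := φ ⟨0, h0⟩ - g 0 φ with hx₀
  let Y := {w : BoundedContinuousFunction ℝ X // ∀ t, t ≤ 0 → w t = φe t}
  have hYc : IsClosed {w : BoundedContinuousFunction ℝ X | ∀ t, t ≤ 0 → w t = φe t} := by
    simp only [ofPred_forall]
    exact isClosed_iInter fun t => isClosed_iInter fun _ =>
      isClosed_eq (continuous_eval_const (F := BoundedContinuousFunction ℝ X) t) continuous_const
  have : CompleteSpace Y := hYc.completeSpace_coe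
  have hhist0 : ∀ w : ℝ → X, Continuous w → (∀ t, t ≤ 0 → w t = φe t) → hist r w 0 = φ := by
    intro w hw hwφ
    ext θ
    rw [hist_apply hw, zero_add, hwφ _ θ.2.2, hφθ]
  have hmild0 : ∀ w : Y, mildMap r S x₀ g f w.1 0 = φ ⟨0, h0⟩ := by
    intro w
    simp [mildMap, hhist0 w.1 w.1.continuous w.2, hS0, hx₀]
  have hstep : ∀ w : Y, ∃ w' : Y, ∀ t, w'.1 t =
      φe t + (mildMap r S x₀ g f w.1 (max t 0) - φ ⟨0, h0⟩) := by
    intro w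
    obtain ⟨B, hB⟩ := h.exists_norm_mildMap_le x₀ w.1.continuous w.1.norm_coe_le_norm
    refine ⟨⟨BoundedContinuousFunction.ofNormedAddCommGroup
      (fun t => φe t + (mildMap r S x₀ g f w.1 (max t 0) - φ ⟨0, h0⟩)) ?_
      (‖φ‖ + (B + ‖φ ⟨0, h0⟩‖)) fun t => ?_, fun t ht => ?_⟩, fun t => rfl⟩
    · exact hφc.add (((h.continuous_mildMap x₀ w.1.continuous).comp
        (continuous_id.max continuous_const)).sub continuous_const)
    · exact (norm_add_le _ _).trans (add_le_add (hφb t)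
        ((norm_sub_le _ _).trans (add_le_add_left (hB _ (le_max_right _ _)) _)))
    · simp [max_eq_right ht, hmild0 w]
  choose Γ hΓ using hstep
  have hΓpos : ∀ w t, 0 ≤ t → (Γ w).1 t = mildMap r S x₀ g f w.1 t := by
    intro w t ht
    rw [hΓ, hφ0 t ht, max_eq_left ht, add_sub_cancel]
  have hcontr : ContractingWith ⟨q, hq0⟩ Γ := by
    refine ⟨hq1, LipschitzWith.of_dist_le_mul fun w v => ?_⟩
    refine (BoundedContinuousFunction.dist_le (mul_nonneg hq0 dist_nonneg)).2 fun t => ?_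
    rw [hΓ, hΓ, dist_add_left, dist_sub_right, dist_eq_norm]
    exact h.norm_mildMap_sub_le x₀ w.1.continuous v.1.continuous dist_nonneg
      (fun s => by rw [← dist_eq_norm]; exact BoundedContinuousFunction.dist_coe_le_dist s)
      (le_max_right _ _)
  let w₀ : Y := ⟨BoundedContinuousFunction.ofNormedAddCommGroup φe hφc ‖φ‖ hφb, fun _ _ => rfl⟩
  have : Nonempty Y := ⟨w₀⟩
  set u : Y := hcontr.fixedPoint Γ with hu
  have hufix : Γ u = u := hcontr.fixedPoint_isFixedPt
  have hupos : ∀ t, 0 ≤ t → u.1 t = mildMap r S x₀ g f u.1 t := fun t ht => by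
    rw [← hΓpos u t ht, hufix]
  have hnull : ∀ n, WindowMeanNull r fun τ => ‖(Γ^[n] w₀).1 (τ + ω) - (Γ^[n] w₀).1 τ‖ₑ := by
    intro n
    induction n with
    | zero =>
      refine WindowMeanNull.zero.mono ?_
      filter_upwards [eventually_ge_atTop 0] with τ hτ
      have : φe (τ + ω) - φe τ = 0 := by
        rw [hφ0 _ (add_nonneg hτ h.omega_nonneg), hφ0 _ hτ, sub_self]
      exact (congrArg (‖·‖ₑ) this).trans_le (by simp)
    | succ n ih =>
      refine (h.windowMeanNull_mildMap x₀ (Γ^[n] w₀).1.continuous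
        (Γ^[n] w₀).1.norm_coe_le_norm ih).mono ?_
      filter_upwards [eventually_ge_atTop 0] with τ hτ
      rw [Function.iterate_succ_apply', hΓpos _ _ hτ, hΓpos _ _ (add_nonneg hτ h.omega_nonneg)]
  have hunull : WindowMeanNull r fun τ => ‖u.1 (τ + ω) - u.1 τ‖ₑ := by
    refine WindowMeanNull.of_forall_le_add fun ε hε => ?_
    obtain ⟨n, hn⟩ := ((Metric.tendsto_nhds.1 (hcontr.tendsto_iterate_fixedPoint w₀)
      (ε / 2) (half_pos hε))).exists
    refine ⟨_, hnull n, Eventually.of_forall fun τ => ?_⟩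
    set w := (Γ^[n] w₀) with hw
    have hd : ∀ s, ‖u.1 s - w.1 s‖ ≤ ε / 2 := fun s => by
      rw [← dist_eq_norm, dist_comm]
      exact (BoundedContinuousFunction.dist_coe_le_dist s).trans hn.le
    rw [← ofReal_norm, ← ofReal_norm, ← ENNReal.ofReal_add (norm_nonneg _) hε.le]
    refine ENNReal.ofReal_le_ofReal ?_
    have hsplit : u.1 (τ + ω) - u.1 τ =
        (w.1 (τ + ω) - w.1 τ) + ((u.1 (τ + ω) - w.1 (τ + ω)) - (u.1 τ - w.1 τ)) := by abel
    rw [hsplit]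
    refine (norm_add_le _ _).trans (add_le_add_right ((norm_sub_le _ _).trans ?_) _)
    linarith [hd (τ + ω), hd τ]
  refine ⟨u.1, ⟨⟨u.1.continuous.continuousOn, ⟨‖u.1‖, fun t _ => u.1.norm_coe_le_norm t⟩,
    fun θ => (u.2 _ θ.2.2).trans (hφθ θ), hupos⟩,
    hunull.psapClass h.r_nonneg h.omega_nonneg fun t _ => u.1.norm_coe_le_norm t⟩, ?_⟩
  intro v hv
  obtain ⟨hvc, ⟨B, hB⟩, hvφ, hveq⟩ := hv
  let v' : Y := ⟨BoundedContinuousFunction.ofNormedAddCommGroup (fun t => v (max t (-r)))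
    (hvc.comp_continuous (by fun_prop) fun t => mem_Ici.2 (le_max_right _ _)) B
    fun t => hB _ (le_max_right _ _), fun t ht => by
      have := hvφ (projIcc (-r) 0 hr t)
      rw [coe_projIcc, min_eq_right ht, max_comm] at this
      · exact this⟩
  have hv' : ∀ t, -r ≤ t → v'.1 t = v t := fun t ht => congrArg v (max_eq_left ht)
  have hfix : Γ v' = v' := by
    refine Subtype.ext (BoundedContinuousFunction.ext fun t => ?_)
    rcases le_total t 0 with ht | ht
    · rw [(Γ v').2 t ht, v'.2 t ht]
    · have hh : ∀ s, 0 ≤ s → hist r v'.1 s = hist r v s := fun s hs =>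
        hist_congr fun θ => hv' _ (by linarith [θ.2.1])
      rw [hΓpos v' t ht, hv' t (by linarith), hveq t ht, mildMap, hh t ht]
      congr 1
      refine intervalIntegral.integral_congr fun s hs => ?_
      rw [uIcc_of_le ht] at hs
      simp only [hh s hs.1]
  have huv : v' = u := hcontr.fixedPoint_unique hfix
  intro t ht
  rw [← hv' t ht, huv]

section Kernel

variable {α μ c : ℝ}

lemma one_le_one_add_abs_mul_rpow (μ α : ℝ) {t : ℝ} (ht : 0 ≤ t) : 1 ≤ 1 + |μ| * t ^ α :=
  le_add_of_nonneg_right (mul_nonneg (abs_nonneg _) (Real.rpow_nonneg ht _))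

lemma continuous_decayKernel (hα : 0 ≤ α) :
    Continuous fun t : ℝ => c / (1 + |μ| * (max t 0) ^ α) := by
  refine continuous_const.div ?_ fun t =>
    (zero_lt_one.trans_le (one_le_one_add_abs_mul_rpow μ α (le_max_right _ _))).ne'
  exact continuous_const.add (continuous_const.mul
    ((continuous_id.max continuous_const).rpow_const fun _ => Or.inr hα))

lemma antitone_decayKernel (hα : 0 ≤ α) (hc : 0 ≤ c) :
    Antitone fun t : ℝ => c / (1 + |μ| * (max t 0) ^ α) := by
  intro s t hst
  have hs := one_le_one_add_abs_mul_rpow μ α (le_max_right s 0)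
  refine div_le_div_of_nonneg_left hc (by linarith) ?_
  gcongr

lemma decayKernel_le (hμ : μ < 0) (hc : 0 ≤ c) {t : ℝ} (ht : 0 < t) :
    c / (1 + |μ| * (max t 0) ^ α) ≤ c / |μ| * t ^ (-α) := by
  have hμ' : 0 < |μ| := abs_pos.2 hμ.ne
  have htα : 0 < t ^ α := Real.rpow_pos_of_pos ht _
  rw [max_eq_left ht.le, Real.rpow_neg ht.le, ← div_eq_mul_inv, div_div]
  exact div_le_div_of_nonneg_left hc (by positivity) (by linarith)

lemma integrableOn_decayKernel (hα : 1 < α) (hμ : μ < 0) (hc : 0 ≤ c) :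
    IntegrableOn (fun t : ℝ => c / (1 + |μ| * (max t 0) ^ α)) (Ici 0) := by
  have hcont := continuous_decayKernel (μ := μ) (c := c) (zero_le_one.trans hα.le)
  rw [← Icc_union_Ioi_eq_Ici (zero_le_one' ℝ)]
  refine hcont.continuousOn.integrableOn_Icc.union ?_
  have hint : IntegrableOn (fun t : ℝ => c / |μ| * t ^ (-α)) (Ioi 1) :=
    (integrableOn_Ioi_rpow_of_lt (by linarith) zero_lt_one).const_mul _
  refine hint.mono' hcont.aestronglyMeasurable
    ((ae_restrict_iff' measurableSet_Ioi).2 (Eventually.of_forall fun t ht => ?_))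
  have h1 := one_le_one_add_abs_mul_rpow μ α (le_max_right t 0)
  rw [Real.norm_of_nonneg (div_nonneg hc (by linarith))]
  exact decayKernel_le hμ hc (zero_lt_one.trans ht)

lemma tendsto_decayKernel (hα : 0 < α) (hμ : μ < 0) (hc : 0 ≤ c) :
    Tendsto (fun t : ℝ => c / (1 + |μ| * (max t 0) ^ α)) atTop (nhds 0) := by
  have hlim : Tendsto (fun t : ℝ => c / |μ| * t ^ (-α)) atTop (nhds 0) := by
    simpa using (tendsto_rpow_neg_atTop hα).const_mul (c / |μ|)
  refine squeeze_zero' (Eventually.of_forall fun t => ?_) ?_ hlim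
  · exact div_nonneg hc (by linarith [one_le_one_add_abs_mul_rpow μ α (le_max_right t 0)])
  · filter_upwards [eventually_gt_atTop 0] with t ht using decayKernel_le hμ hc ht

end Kernel

lemma PSAPunif.comp_max_zero {E Y : Type*} [NormedAddCommGroup E] [NormedAddCommGroup Y]
    {ω r : ℝ} (hω : 0 ≤ ω) {F : ℝ → E → Y} (hF : PSAPunif ω r F) :
    PSAPunif ω r fun t => F (max t 0) := by
  intro L hL
  refine (hF L hL).congr' ?_
  filter_upwards [eventually_ge_atTop r] with T hT
  congr 1
  refine intervalIntegral.integral_congr fun s hs => ?_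
  rw [uIcc_of_le hT] at hs
  refine iSup_congr fun τ => iSup_congr fun hτ => ?_
  have h0 : 0 ≤ τ := by linarith [hτ.1, hs.1]
  rw [max_eq_left h0, max_eq_left (add_nonneg h0 hω)]

/-- Theorem 3.3: under hypotheses (H₁), (H₄) and the smallness
condition `CM·sup_{t≥0} W_f(t) + ‖L_g‖_∞ < 1`, where
`W_f(t) = ∫_0^t L_f(s)/(1+|μ|(t−s)^α) ds`, system (1.2) has a unique mild solution `u`
with `u|_{[0,∞)} ∈ PSAP_{ω,r}(X)`. -/
theorem existence_uniqueness_thm33 {X : Type*} [NormedAddCommGroup X] [NormedSpace ℝ X]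
    [CompleteSpace X]
    (α μ C M r ω : ℝ) (hα1 : 1 < α) (hα2 : α < 2) (hμ : μ < 0) (hC : 0 < C) (hM : 0 < M)
    (hr : 0 < r) (hω : 0 < ω)
    (S : ℝ → X →L[ℝ] X)
    (hScont : ∀ x : X, ContinuousOn (fun t => S t x) (Set.Ici 0))
    (hS0 : S 0 = 1)
    (hSb : ∀ t ≥ (0:ℝ), ‖S t‖ ≤ C * M / (1 + |μ| * t ^ α))
    (φ : C(Set.Icc (-r) (0:ℝ), X))
    (g f : ℝ → C(Set.Icc (-r) (0:ℝ), X) → X)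
    (hgcont : ContinuousOn (fun p : ℝ × C(Set.Icc (-r) (0:ℝ), X) => g p.1 p.2)
      (Set.Ici 0 ×ˢ Set.univ))
    (hfcont : ContinuousOn (fun p : ℝ × C(Set.Icc (-r) (0:ℝ), X) => f p.1 p.2)
      (Set.Ici 0 ×ˢ Set.univ))
    (hgP : PSAPunif ω r g) (hfP : PSAPunif ω r f)
    (hg0 : ∃ B, ∀ t ≥ (0:ℝ), ‖g t 0‖ ≤ B) (hf0 : ∃ B, ∀ t ≥ (0:ℝ), ‖f t 0‖ ≤ B)
    (Lg Lf : ℝ → ℝ)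
    (hLgcont : ContinuousOn Lg (Set.Ici 0)) (hLfcont : ContinuousOn Lf (Set.Ici 0))
    (hLgpos : ∀ t ≥ (0:ℝ), 0 ≤ Lg t) (hLfpos : ∀ t ≥ (0:ℝ), 0 ≤ Lf t)
    (hLgbdd : ∃ B, ∀ t ≥ (0:ℝ), Lg t ≤ B) (hLfbdd : ∃ B, ∀ t ≥ (0:ℝ), Lf t ≤ B)
    (hLfloc : LocallyIntegrableOn Lf (Set.Ici 0))
    (hgLip : ∀ t ≥ (0:ℝ), ∀ ψ₁ ψ₂ : C(Set.Icc (-r) (0:ℝ), X),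
      ‖g t ψ₁ - g t ψ₂‖ ≤ Lg t * ‖ψ₁ - ψ₂‖)
    (hfLip : ∀ t ≥ (0:ℝ), ∀ ψ₁ ψ₂ : C(Set.Icc (-r) (0:ℝ), X),
      ‖f t ψ₁ - f t ψ₂‖ ≤ Lf t * ‖ψ₁ - ψ₂‖)
    (hWbdd : BddAbove
      ((fun t : ℝ => ∫ s in (0:ℝ)..t, Lf s / (1 + |μ| * (t - s) ^ α)) '' Set.Ici 0))
    (hsmall : C * M *
        (⨆ t ∈ Set.Ici (0:ℝ), ∫ s in (0:ℝ)..t, Lf s / (1 + |μ| * (t - s) ^ α)) +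
        (⨆ t ∈ Set.Ici (0:ℝ), Lg t) < 1) :
    ∃ u : ℝ → X,
      (IsMildSolution r (Set.right_mem_Icc.mpr (by linarith)) S φ g f u ∧ PSAPclass ω r u) ∧
      ∀ v : ℝ → X,
        IsMildSolution r (Set.right_mem_Icc.mpr (by linarith)) S φ g f v ∧ PSAPclass ω r v →
        ∀ t ≥ -r, v t = u t := by
  have hcm : 0 ≤ C * M := (mul_pos hC hM).le
  have hα0 : 0 < α := zero_lt_one.trans hα1
  obtain ⟨Bg, hBg⟩ := hg0
  obtain ⟨Bf, hBf⟩ := hf0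
  obtain ⟨bg, hbg⟩ := hLgbdd
  obtain ⟨bf, hbf⟩ := hLfbdd
  obtain ⟨bW, hbW⟩ := hWbdd
  set W : ℝ → ℝ := fun t => ∫ s in (0:ℝ)..t, Lf s / (1 + |μ| * (t - s) ^ α) with hW
  have hW0 : ∀ t ∈ Ici (0 : ℝ), 0 ≤ W t := fun t ht =>
    intervalIntegral.integral_nonneg ht fun s hs => div_nonneg (hLfpos s hs.1)
      (by linarith [one_le_one_add_abs_mul_rpow μ α (sub_nonneg.2 hs.2)])
  have hWle : ∀ t ∈ Ici (0 : ℝ), W t ≤ ⨆ t ∈ Ici (0 : ℝ), W t := fun t ht =>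
    Real.le_biSup_of_nonneg hW0 (fun s hs => hbW (mem_image_of_mem W hs)) ht
  have hLgle : ∀ t ∈ Ici (0 : ℝ), Lg t ≤ ⨆ t ∈ Ici (0 : ℝ), Lg t := fun t ht =>
    Real.le_biSup_of_nonneg (f := Lg) hLgpos hbg ht
  have hmax : ∀ t : ℝ, 0 ≤ max t 0 := fun t => le_max_right _ _
  have hmaxc : Continuous fun t : ℝ => max t 0 := by fun_prop
  set k : ℝ → ℝ := fun t => C * M / (1 + |μ| * (max t 0) ^ α) with hk
  have hka : Antitone k := antitone_decayKernel hα0.le hcm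
  have hkle : ∀ t, k t ≤ C * M := fun t =>
    div_le_self hcm (one_le_one_add_abs_mul_rpow μ α (hmax t))
  have hcont : ∀ {F : ℝ → C(Set.Icc (-r) (0:ℝ), X) → X},
      ContinuousOn (fun p : ℝ × C(Set.Icc (-r) (0:ℝ), X) => F p.1 p.2) (Set.Ici 0 ×ˢ Set.univ) →
      Continuous fun p : ℝ × C(Set.Icc (-r) (0:ℝ), X) => F (max p.1 0) p.2 := fun hF =>
    hF.comp_continuous (f := fun p : ℝ × C(Set.Icc (-r) (0:ℝ), X) => (max p.1 0, p.2))
      (by fun_prop) fun p => ⟨hmax _, mem_univ _⟩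
  have hdata : MildData r ω (C * M * (⨆ t ∈ Ici (0 : ℝ), W t) + ⨆ t ∈ Ici (0 : ℝ), Lg t)
      (fun t => S (max t 0)) k (fun t => Lg (max t 0)) (fun t => Lf (max t 0))
      (fun t => g (max t 0)) (fun t => f (max t 0)) :=
    { r_nonneg := hr.le
      omega_nonneg := hω.le
      continuous_S := fun x => (hScont x).comp_continuous hmaxc hmax
      norm_S_le := fun t => hSb _ (hmax t)
      continuous_k := continuous_decayKernel hα0.le
      antitone_k := hka
      exists_k_le := ⟨_, hkle⟩
      integrable_k := integrableOn_decayKernel hα1 hμ hcm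
      tendsto_k := tendsto_decayKernel hα0 hμ hcm
      continuous_g := hcont hgcont
      continuous_f := hcont hfcont
      exists_g_le := ⟨Bg, fun t => hBg _ (hmax t)⟩
      exists_f_le := ⟨Bf, fun t => hBf _ (hmax t)⟩
      exists_Lg_le := ⟨bg, fun t => hbg _ (hmax t)⟩
      exists_Lf_le := ⟨bf, fun t => hbf _ (hmax t)⟩
      Lg_nonneg := fun t => hLgpos _ (hmax t)
      Lf_nonneg := fun t => hLfpos _ (hmax t)
      continuous_Lf := hLfcont.comp_continuous hmaxc hmax
      lipschitz_g := fun t => hgLip _ (hmax t)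
      lipschitz_f := fun t => hfLip _ (hmax t)
      psap_g := hgP.comp_max_zero hω.le
      psap_f := hfP.comp_max_zero hω.le
      contraction := fun t ht => by
        have hint : ∫ s in (0 : ℝ)..t, k (t - s) * Lf (max s 0) = C * M * W t := by
          rw [hW, ← intervalIntegral.integral_const_mul]
          refine intervalIntegral.integral_congr fun s hs => ?_
          rw [uIcc_of_le ht] at hs
          simp only [hk, max_eq_left hs.1, max_eq_left (sub_nonneg.2 hs.2)]
          ring
        rw [hint, max_eq_left ht]
        exact add_le_add (mul_le_mul_of_nonneg_left (hWle t ht) hcm) (hLgle t ht) }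
  have hq0 : 0 ≤ C * M * (⨆ t ∈ Ici (0 : ℝ), W t) + ⨆ t ∈ Ici (0 : ℝ), Lg t :=
    add_nonneg (mul_nonneg hcm (Real.biSup_nonneg hW0)) (Real.biSup_nonneg hLgpos)
  have heq : ∀ {Z : Type _} (F : ℝ → Z), EqOn (fun t => F (max t 0)) F (Ici 0) :=
    fun F t ht => congrArg F (max_eq_left ht)
  obtain ⟨u, ⟨hu, huP⟩, huniq⟩ := hdata.exists_unique_isMildSolution hq0 hsmall
    (by simpa using hS0) (Set.right_mem_Icc.mpr (by linarith)) φ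
  exact ⟨u, ⟨hu.congr (heq S) (heq g) (heq f), huP⟩, fun v hv =>
    huniq v (hv.1.congr (heq S).symm (heq g).symm (heq f).symm)⟩
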